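/- Every uplifting cardinal κ has a function with the uplifting Menas property: there exists a function f : κ → κ such that for every ordinal θ there is an inaccessible cardinal γ ≥ θ with κ < γ and a function f* : γ → γ such that ⟨V_κ, ∈, f⟩ ≺ ⟨V_γ, ∈, f*⟩ and f*(κ) ≥ θ. Indeed, the failure-of-upliftingness function, which maps each non-uplifting cardinal δ < κ to the supremum of the inaccessible cardinals γ with V_δ ≺ V_γ, is such a function. -/

import Mathlib

open FirstOrder Language

universe u

namespace Paper

/-- The language of set theory: a single binary relation symbol (membership).
We reuse `FirstOrder.Language.graph`, whose sole symbol is a binary relation. -/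
abbrev LSet : FirstOrder.Language := FirstOrder.Language.graph

/-- The rank-initial segment `V_α` of the cumulative hierarchy, realized as the
collection of ZF sets of rank less than `α`. -/
abbrev Vt (α : Ordinal) : Type 1 := {x : ZFSet // x.rank < α}

/-- `V_α` as a structure in the language of set theory, with the membership relation. -/
instance VtStructure (α : Ordinal) : LSet.Structure (Vt α) where
  funMap := fun f _ => f.elim
  RelMap := fun r x => match r with | .adj => (x 0).1 ∈ (x 1).1

/-- The universe of sets as a structure in the language of set theory. -/
instance ZFSetStructure : LSet.Structure ZFSet where
  funMap := fun f _ => f.elim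
  RelMap := fun r x => match r with | .adj => x 0 ∈ x 1

/-- `V_α ≺ V_β`: the inclusion of `V_α` into `V_β` is an elementary embedding. -/
def VElem (α β : Ordinal) : Prop :=
  ∃ e : Vt α ↪ₑ[LSet] Vt β, ∀ x : Vt α, (e x : ZFSet) = x

/-- An ordinal which is a cardinal. -/
def IsCardOrd (γ : Ordinal) : Prop := γ.card.ord = γ

/-- An ordinal which is a regular cardinal. -/
def IsRegularOrd (γ : Ordinal) : Prop := γ.card.IsRegular ∧ γ.card.ord = γ

/-- An ordinal which is an inaccessible cardinal (uncountable, regular, strong limit). -/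
def IsInaccOrd (γ : Ordinal) : Prop := γ.card.IsInaccessible ∧ γ.card.ord = γ

/-- An inaccessible cardinal `κ` is uplifting if for every ordinal `θ` there is an
inaccessible cardinal `γ ≥ θ` such that `V_κ ≺ V_γ` is a proper elementary extension. -/
def IsUplifting (κ : Ordinal) : Prop :=
  IsInaccOrd κ ∧ ∀ θ : Ordinal, ∃ γ : Ordinal, IsInaccOrd γ ∧ θ ≤ γ ∧ κ < γ ∧ VElem κ γ

/-- An inaccessible cardinal `κ` is pseudo uplifting if for every ordinal `θ` there is a
cardinal `γ ≥ θ` such that `V_κ ≺ V_γ` is a proper elementary extension. -/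
def IsPseudoUplifting (κ : Ordinal) : Prop :=
  IsInaccOrd κ ∧ ∀ θ : Ordinal, ∃ γ : Ordinal, IsCardOrd γ ∧ θ ≤ γ ∧ κ < γ ∧ VElem κ γ

/-- Function symbols for the language of set theory with an added unary function symbol. -/
inductive LFFun : ℕ → Type
  | fsym : LFFun 1

/-- Relation symbols for the language of set theory with an added unary function symbol. -/
inductive LFRel : ℕ → Type
  | mem : LFRel 2

/-- The language of set theory augmented by one unary function symbol. -/
def LF : FirstOrder.Language := ⟨LFFun, LFRel⟩

open Classical in
/-- The interpretation on `V_α` of the unary function symbol corresponding to an ordinal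
function `f`: an element coding a von Neumann ordinal `β` is sent to the von Neumann
ordinal coding `f β` (when it lies in `V_α`), and the function is the identity off the
ordinals.  (A von Neumann ordinal is recovered from its rank.) -/
noncomputable def fInterp (α : Ordinal) (f : Ordinal → Ordinal) (x : Vt α) : Vt α :=
  if h : x.1.IsOrdinal ∧ ∃ y : ZFSet, y.IsOrdinal ∧ y.rank = f x.1.rank ∧ y.rank < α then
    ⟨h.2.choose, h.2.choose_spec.2.2⟩
  else x

/-- The structure `⟨V_α, ∈, f⟩` for an ordinal function `f`. -/
noncomputable def LFStructure (α : Ordinal) (f : Ordinal → Ordinal) : LF.Structure (Vt α) where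
  funMap := fun r x => match r with | .fsym => fInterp α f (x 0)
  RelMap := fun r x => match r with | .mem => (x 0).1 ∈ (x 1).1

/-- `⟨V_α, ∈, f⟩ ≺ ⟨V_β, ∈, g⟩`: the inclusion of `V_α` into `V_β` is an elementary
embedding of the expanded structures. -/
def FVElem (α β : Ordinal) (f g : Ordinal → Ordinal) : Prop :=
  letI := LFStructure α f
  letI := LFStructure β g
  ∃ e : Vt α ↪ₑ[LF] Vt β, ∀ x : Vt α, (e x : ZFSet) = x

/-- `f : κ → κ` has the uplifting Menas property for `κ`: for every ordinal `θ` there is an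
inaccessible cardinal `γ ≥ θ` with `κ < γ` and a function `f* : γ → γ` such that
`⟨V_κ, ∈, f⟩ ≺ ⟨V_γ, ∈, f*⟩` and `f*(κ) ≥ θ`. -/
def MenasFor (f : Ordinal → Ordinal) (κ : Ordinal) : Prop :=
  (∀ δ < κ, f δ < κ) ∧
  ∀ θ : Ordinal, ∃ (γ : Ordinal) (g : Ordinal → Ordinal),
    IsInaccOrd γ ∧ θ ≤ γ ∧ κ < γ ∧ (∀ δ < γ, g δ < γ) ∧ FVElem κ γ f g ∧ θ ≤ g κ

/-- The failure-of-upliftingness function: `δ` is sent to the supremum of the inaccessible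
cardinals `γ` for which `V_δ ≺ V_γ`. -/
noncomputable def failUplift (δ : Ordinal) : Ordinal :=
  sSup {γ : Ordinal | IsInaccOrd γ ∧ VElem δ γ}

/-! ### Uniform definability over the levels `V_γ` -/

/-- A family of predicates on assignments into the levels `V_γ` is uniformly definable if a single
formula of set theory defines all its members at inaccessible `γ`. -/
def UDefinable {α : Type} (P : ∀ γ : Ordinal, (α → Vt γ) → Prop) : Prop :=
  ∃ φ : LSet.Formula α, ∀ γ, IsInaccOrd γ → ∀ v : α → Vt γ, φ.Realize v ↔ P γ v

namespace UDefinable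

variable {α β : Type} {P Q : ∀ γ : Ordinal, (α → Vt γ) → Prop}

theorem congr (h : UDefinable P) (hPQ : ∀ γ, IsInaccOrd γ → ∀ v : α → Vt γ, Q γ v ↔ P γ v) :
    UDefinable Q := by
  obtain ⟨φ, hφ⟩ := h
  exact ⟨φ, fun γ hγ v => (hφ γ hγ v).trans (hPQ γ hγ v).symm⟩

theorem comap (f : α → β) (h : UDefinable P) : UDefinable fun γ v => P γ fun a => v (f a) := by
  obtain ⟨φ, hφ⟩ := h
  refine ⟨φ.relabel f, fun γ hγ v => ?_⟩
  rw [Formula.realize_relabel]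
  exact hφ γ hγ _

theorem mem (a b : α) : UDefinable fun _ v => (v a).1 ∈ (v b).1 := by
  refine ⟨Relations.formula₂ (L := LSet) adj (Term.var a) (Term.var b), fun γ _ v => ?_⟩
  exact Formula.realize_rel₂.trans Iff.rfl

theorem eq (a b : α) : UDefinable fun _ v => v a = v b := by
  refine ⟨Term.equal (Term.var a) (Term.var b), fun γ _ v => ?_⟩
  rw [Formula.realize_equal]
  rfl

theorem not (h : UDefinable P) : UDefinable fun γ v => ¬ P γ v := by
  obtain ⟨φ, hφ⟩ := h
  refine ⟨φ.not, fun γ hγ v => ?_⟩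
  rw [Formula.realize_not, hφ γ hγ]

theorem imp (hP : UDefinable P) (hQ : UDefinable Q) : UDefinable fun γ v => P γ v → Q γ v := by
  obtain ⟨φ, hφ⟩ := hP
  obtain ⟨ψ, hψ⟩ := hQ
  refine ⟨φ.imp ψ, fun γ hγ v => ?_⟩
  rw [Formula.realize_imp, hφ γ hγ, hψ γ hγ]

theorem and (hP : UDefinable P) (hQ : UDefinable Q) : UDefinable fun γ v => P γ v ∧ Q γ v :=
  (hP.imp hQ.not).not.congr fun _ _ _ => by tauto

theorem or (hP : UDefinable P) (hQ : UDefinable Q) : UDefinable fun γ v => P γ v ∨ Q γ v :=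
  (hP.not.imp hQ).congr fun _ _ _ => by tauto

theorem iff (hP : UDefinable P) (hQ : UDefinable Q) : UDefinable fun γ v => P γ v ↔ Q γ v :=
  ((hP.imp hQ).and (hQ.imp hP)).congr fun _ _ _ => by tauto

theorem all {B : ∀ γ : Ordinal, (α → Vt γ) → Vt γ → Prop}
    (h : UDefinable fun γ (w : Option α → Vt γ) => B γ (fun a => w (some a)) (w none)) :
    UDefinable fun γ v => ∀ x, B γ v x := by
  obtain ⟨φ, hφ⟩ := h
  refine ⟨Formula.iAlls Unit (φ.relabel fun o => o.elim (Sum.inr ()) Sum.inl), fun γ hγ v => ?_⟩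
  simp only [Formula.realize_iAlls, Formula.realize_relabel, hφ γ hγ]
  exact ⟨fun h x => h fun _ => x, fun h i => h _⟩

theorem ex {B : ∀ γ : Ordinal, (α → Vt γ) → Vt γ → Prop}
    (h : UDefinable fun γ (w : Option α → Vt γ) => B γ (fun a => w (some a)) (w none)) :
    UDefinable fun γ v => ∃ x, B γ v x :=
  (all (B := fun γ v x => ¬ B γ v x) h.not).not.congr fun _ _ _ => by simp

end UDefinable

/-- Elementarity of `V_κ` in `V_γ` transfers uniformly definable predicates. -/
theorem VElem.transfer {κ γ : Ordinal} (h : VElem κ γ) (hκ : IsInaccOrd κ) (hγ : IsInaccOrd γ)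
    (hle : κ ≤ γ) {α : Type} {P : ∀ γ : Ordinal, (α → Vt γ) → Prop} (hP : UDefinable P)
    (v : α → Vt κ) : P γ (fun a => ⟨(v a).1, (v a).2.trans_le hle⟩) ↔ P κ v := by
  obtain ⟨e, he⟩ := h
  obtain ⟨φ, hφ⟩ := hP
  rw [← hφ γ hγ, ← hφ κ hκ, ← e.map_formula]
  have : (e ∘ v) = fun a => ⟨(v a).1, (v a).2.trans_le hle⟩ :=
    funext fun a => Subtype.ext (he (v a))
  rw [this]

/-! ### Closure properties of the levels -/

theorem IsInaccOrd.isSuccLimit {γ : Ordinal} (h : IsInaccOrd γ) : Order.IsSuccLimit γ := by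
  rw [← h.2]
  exact Cardinal.isSuccLimit_ord h.1.1.le

theorem IsInaccOrd.omega_lt {γ : Ordinal} (h : IsInaccOrd γ) : Ordinal.omega0 < γ := by
  rw [← h.2, Cardinal.lt_ord, Ordinal.card_omega0]
  exact h.1.1

theorem IsInaccOrd.pos {γ : Ordinal} (h : IsInaccOrd γ) : 0 < γ :=
  Ordinal.omega0_pos.trans h.omega_lt

theorem rank_pair_lt {γ : Ordinal} (h : Order.IsSuccLimit γ) {x y : ZFSet} (hx : x.rank < γ)
    (hy : y.rank < γ) : (ZFSet.pair x y).rank < γ := by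
  simp only [ZFSet.pair, ZFSet.rank_pair, ZFSet.rank_singleton]
  refine max_lt ?_ ?_ <;> refine h.succ_lt ?_
  · exact h.succ_lt hx
  · exact max_lt (h.succ_lt hx) (h.succ_lt hy)

theorem rank_lt_of_mem_Vt {γ : Ordinal} (x : Vt γ) {y : ZFSet} (hy : y ∈ x.1) : y.rank < γ :=
  (ZFSet.rank_lt_of_mem hy).trans x.2

theorem UDefinable.eq_pair {α : Type} (p a b : α) :
    UDefinable fun _ v => (v p).1 = ZFSet.pair (v a).1 (v b).1 := by
  have h : UDefinable fun γ v => ∀ z : Vt γ, z.1 ∈ (v p).1 ↔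
      ((∀ w : Vt γ, w.1 ∈ z.1 ↔ w = v a) ∨ (∀ w : Vt γ, w.1 ∈ z.1 ↔ (w = v a ∨ w = v b))) :=
    .all (.iff (.mem _ _) (.or (.all (.iff (.mem _ _) (.eq _ _)))
      (.all (.iff (.mem _ _) (.or (.eq _ _) (.eq _ _))))))
  refine h.congr fun γ hγ v => ?_
  have h1 : ∀ z : Vt γ, (∀ w : Vt γ, w.1 ∈ z.1 ↔ w = v a) ↔ z.1 = {(v a).1} := fun z => by
    refine ⟨fun h => ZFSet.ext fun w => ?_, fun h w => by simp [h, Subtype.ext_iff]⟩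
    rw [ZFSet.mem_singleton]
    refine ⟨fun hw => congrArg Subtype.val ((h ⟨w, rank_lt_of_mem_Vt z hw⟩).1 hw), ?_⟩
    rintro rfl
    exact (h (v a)).2 rfl
  have h2 : ∀ z : Vt γ, (∀ w : Vt γ, w.1 ∈ z.1 ↔ (w = v a ∨ w = v b)) ↔
      z.1 = {(v a).1, (v b).1} := fun z => by
    refine ⟨fun h => ZFSet.ext fun w => ?_, fun h w => by simp [h, Subtype.ext_iff]⟩
    rw [ZFSet.mem_pair]
    refine ⟨fun hw => ?_, ?_⟩
    · simpa [Subtype.ext_iff] using (h ⟨w, rank_lt_of_mem_Vt z hw⟩).1 hw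
    · rintro (rfl | rfl)
      · exact (h (v a)).2 (.inl rfl)
      · exact (h (v b)).2 (.inr rfl)
  simp only [h1, h2]
  refine ⟨fun h z => by simp [h, ZFSet.pair], fun h => ZFSet.ext fun z => ?_⟩
  rw [ZFSet.pair, ZFSet.mem_pair]
  refine ⟨fun hz => (h ⟨z, rank_lt_of_mem_Vt _ hz⟩).1 hz, fun hz => ?_⟩
  have hr := rank_pair_lt hγ.isSuccLimit (v a).2 (v b).2
  exact (h ⟨z, (ZFSet.rank_lt_of_mem (by rwa [ZFSet.pair, ZFSet.mem_pair])).trans hr⟩).2 hz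

theorem UDefinable.pair_mem {α : Type} (a b s : α) :
    UDefinable fun _ v => ZFSet.pair (v a).1 (v b).1 ∈ (v s).1 := by
  have h : UDefinable fun γ v => ∃ p : Vt γ, p.1 ∈ (v s).1 ∧ p.1 = ZFSet.pair (v a).1 (v b).1 :=
    .ex (.and (.mem _ _) (.eq_pair _ _ _))
  refine h.congr fun γ hγ v => ⟨fun h => ⟨⟨_, rank_lt_of_mem_Vt _ h⟩, h, rfl⟩, ?_⟩
  rintro ⟨p, hp, h⟩
  rwa [← h]

/-- A rank-bounded class of sets is an element of every sufficiently high level. -/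
theorem exists_Vt_mem_iff {γ μ : Ordinal} (hμ : μ < γ) (p : ZFSet → Prop)
    (hp : ∀ x, p x → x.rank < μ) : ∃ s : Vt γ, ∀ x, x ∈ s.1 ↔ p x := by
  have key : ∀ x, x ∈ ZFSet.sep p (ZFSet.vonNeumann μ) ↔ p x := fun x => by
    rw [ZFSet.mem_sep, ZFSet.mem_vonNeumann]
    exact ⟨And.right, fun h => ⟨hp x h, h⟩⟩
  refine ⟨⟨ZFSet.sep p (ZFSet.vonNeumann μ), lt_of_le_of_lt ?_ hμ⟩, key⟩
  exact ZFSet.rank_le_iff.2 fun x hx => hp x ((key x).1 hx)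

/-- Comparison of ranks is definable: `x` has rank at most that of `y` exactly if some relation
containing `(x, y)` simulates membership. -/
theorem UDefinable.rank_le {α : Type} (a b : α) :
    UDefinable fun _ v => (v a).1.rank ≤ (v b).1.rank := by
  have h : UDefinable fun γ v => ∃ R : Vt γ, ZFSet.pair (v a).1 (v b).1 ∈ R.1 ∧
      ∀ x y : Vt γ, ZFSet.pair x.1 y.1 ∈ R.1 → ∀ x' : Vt γ, x'.1 ∈ x.1 →
        ∃ y' : Vt γ, y'.1 ∈ y.1 ∧ ZFSet.pair x'.1 y'.1 ∈ R.1 :=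
    .ex (.and (.pair_mem _ _ _) (.all (.all (.imp (.pair_mem _ _ _) (.all (.imp (.mem _ _)
      (.ex (.and (.mem _ _) (.pair_mem _ _ _)))))))))
  refine h.congr fun γ hγ v => ⟨fun h => ?_, ?_⟩
  · have hlim := hγ.isSuccLimit
    set M := max (v a).1.rank (v b).1.rank
    have hM : M < γ := max_lt (v a).2 (v b).2
    have hpr : ∀ x y : ZFSet, x.rank ≤ M → y.rank ≤ M →
        (ZFSet.pair x y).rank < Order.succ (Order.succ (Order.succ M)) := fun x y hx hy => by
      simp only [ZFSet.pair, ZFSet.rank_pair, ZFSet.rank_singleton]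
      simp [hx, hy]
    obtain ⟨R, hR⟩ := exists_Vt_mem_iff (hlim.succ_lt (hlim.succ_lt (hlim.succ_lt hM)))
      (fun p => ∃ x y : ZFSet, x.rank ≤ y.rank ∧ x.rank ≤ M ∧ y.rank ≤ M ∧ p = ZFSet.pair x y)
      (by rintro _ ⟨x, y, -, hx, hy, rfl⟩; exact hpr x y hx hy)
    refine ⟨R, (hR _).2 ⟨_, _, h, le_max_left _ _, le_max_right _ _, rfl⟩, ?_⟩
    intro x y hxy x' hx'
    obtain ⟨x₀, y₀, hle, hxM, hyM, heq⟩ := (hR _).1 hxy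
    obtain ⟨rfl, rfl⟩ := ZFSet.pair_inj.1 heq
    have hlt := ZFSet.rank_lt_of_mem hx'
    obtain ⟨y', hy', hle'⟩ := ZFSet.lt_rank_iff.1 (hlt.trans_le hle)
    exact ⟨⟨y', rank_lt_of_mem_Vt _ hy'⟩, hy', (hR _).2 ⟨_, _, hle', hlt.le.trans hxM,
      (ZFSet.rank_lt_of_mem hy').le.trans hyM, rfl⟩⟩
  · rintro ⟨R, hab, hR⟩
    have key : ∀ x : ZFSet, ∀ hx : x.rank < γ, ∀ y : Vt γ, ZFSet.pair x y.1 ∈ R.1 →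
        x.rank ≤ y.1.rank := by
      intro x
      induction x using ZFSet.inductionOn with
      | _ x ih =>
        intro hx y hxy
        refine ZFSet.rank_le_iff.2 fun x' hx' => ?_
        have hx'γ := (ZFSet.rank_lt_of_mem hx').trans hx
        obtain ⟨y', hy', h'⟩ := hR ⟨x, hx⟩ y hxy ⟨x', hx'γ⟩ hx'
        exact (ih x' hx' hx'γ y' h').trans_lt (ZFSet.rank_lt_of_mem hy')
    exact key _ (v a).2 _ hab

theorem UDefinable.rank_lt {α : Type} (a b : α) :
    UDefinable fun _ v => (v a).1.rank < (v b).1.rank :=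
  (UDefinable.rank_le b a).not.congr fun _ _ _ => not_le.symm

/-! ### Definability of inaccessibility -/

/-- Replacement for `V_μ`: functions from an element of `V_μ` to ordinals below `μ` are bounded
below `μ`. -/
def RankReplacement (μ : Ordinal.{u}) : Prop :=
  ∀ a : ZFSet, a.rank < μ → ∀ F : ZFSet → Ordinal, (∀ x ∈ a, F x < μ) →
    ∃ β < μ, ∀ x ∈ a, F x < β

theorem RankReplacement.bounded {μ : Ordinal.{u}} (h : RankReplacement μ) {a : ZFSet}
    (ha : a.rank < μ) {X : Type u} (hX : Cardinal.mk X ≤ a.card) (f : X → Ordinal)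
    (hf : ∀ x, f x < μ) : ∃ β < μ, ∀ x, f x < β := by
  classical
  obtain ⟨g⟩ : Nonempty (X ↪ Shrink a) := hX
  let G : X → ZFSet := fun x => ((equivShrink a).symm (g x)).1
  have hG : Function.Injective G := fun x y hxy =>
    g.injective ((equivShrink a).symm.injective (Subtype.ext hxy))
  obtain ⟨β, hβ, hFβ⟩ := h a ha (fun y => if h : ∃ x, G x = y then f h.choose else 0) fun y _ => by
    split_ifs
    · exact hf _
    · exact zero_le.trans_lt ha
  refine ⟨β, hβ, fun x => ?_⟩
  have hx := hFβ (G x) ((equivShrink a).symm (g x)).2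
  have hex : ∃ y, G y = G x := ⟨x, rfl⟩
  rw [dif_pos hex, hG hex.choose_spec] at hx
  exact hx

theorem RankReplacement.card_lt {μ : Ordinal} (h : RankReplacement μ) {a : ZFSet}
    (ha : a.rank < μ) : a.card < μ.card := by
  by_contra! hle
  obtain ⟨β, hβ, hf⟩ := h.bounded ha (X := μ.ToType) (by rwa [Cardinal.mk_toType])
    (fun x => (Ordinal.ToType.mk.symm x).1) (fun x => (Ordinal.ToType.mk.symm x).2)
  have := hf (Ordinal.ToType.mk ⟨β, hβ⟩)
  simp at this

theorem isInaccOrd_iff {μ : Ordinal} :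
    IsInaccOrd μ ↔ Ordinal.omega0 < μ ∧ RankReplacement μ := by
  constructor
  · intro h
    refine ⟨h.omega_lt, fun a ha F hF => ?_⟩
    have hcard : a.card < μ.cof := by
      have h1 : a.card ≤ Cardinal.preBeth a.rank := by
        rw [← ZFSet.card_vonNeumann]
        exact ZFSet.card_mono (ZFSet.subset_vonNeumann_self a)
      have h2 : Cardinal.preBeth μ = μ.card := by
        have := h.1.preBeth_ord
        rwa [h.2] at this
      have h3 := h.1.le_cof_ord
      rw [h.2] at h3
      exact (h1.trans_lt (Cardinal.preBeth_strictMono ha)).trans_le (h2.trans_le h3)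
    refine ⟨⨆ i : Shrink a, F ((equivShrink a).symm i).1 + 1,
      Ordinal.iSup_add_one_lt_of_lt_cof hcard fun i => hF _ ((equivShrink a).symm i).2, ?_⟩
    intro x hx
    have := Ordinal.lt_iSup_add_one (fun i : Shrink a => F ((equivShrink a).symm i).1)
      (equivShrink a ⟨x, hx⟩)
    simpa using this
  · rintro ⟨hω, h⟩
    have hord : μ.card.ord = μ := by
      refine (Cardinal.ord_card_le μ).eq_of_not_lt fun hlt => ?_
      have := h.card_lt (a := μ.card.ord.toZFSet) (by simpa using hlt)
      simp at this
    have hlim : Order.IsSuccLimit μ := by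
      rw [← hord]
      refine Cardinal.isSuccLimit_ord ?_
      simpa using Ordinal.card_le_card hω.le
    refine ⟨⟨?_, ?_, fun c hc => ?_⟩, hord⟩
    · rwa [← Ordinal.card_omega0, ← Cardinal.lt_ord, hord]
    · rw [hord]
      by_contra! hlt
      obtain ⟨s, hs, hscard⟩ := Order.exists_cof_eq μ.ToType
      rw [Ordinal.cof_toType] at hscard
      obtain ⟨β, hβ, hf⟩ := h.bounded (a := μ.cof.ord.toZFSet) (X := s)
        (by
          rw [Ordinal.rank_toZFSet]
          calc μ.cof.ord < μ.card.ord := Cardinal.ord_lt_ord.2 hlt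
            _ = μ := hord)
        (by simp [hscard])
        (fun x => (Ordinal.ToType.mk.symm x.1).1) (fun x => (Ordinal.ToType.mk.symm x.1).2)
      obtain ⟨x, hx, hle⟩ := hs (Ordinal.ToType.mk ⟨β, hβ⟩)
      exact (Subtype.coe_le_coe.2 (Ordinal.ToType.mk.le_symm_apply.2 hle)).not_gt (hf ⟨x, hx⟩)
    · have := h.card_lt (a := ZFSet.powerset c.ord.toZFSet) (by
        rw [ZFSet.rank_powerset, Ordinal.rank_toZFSet]
        refine hlim.succ_lt ?_
        rw [← hord]
        exact Cardinal.ord_lt_ord.2 hc)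
      simpa using this

/-- A level `V_μ` contains an infinite set exactly if `ω < μ`. -/
theorem omega_lt_iff {μ : Ordinal} : Ordinal.omega0 < μ ↔
    ∃ w : ZFSet, w.rank < μ ∧ (∃ x, x ∈ w) ∧ ∀ x ∈ w, ∃ y ∈ w, x ∈ y := by
  constructor
  · intro h
    refine ⟨Ordinal.omega0.toZFSet, by simpa using h, ⟨(0 : Ordinal).toZFSet, ?_⟩, fun x hx => ?_⟩
    · exact Ordinal.toZFSet_mem_toZFSet_iff.2 Ordinal.omega0_pos
    · obtain ⟨a, ha, rfl⟩ := Ordinal.mem_toZFSet_iff.1 hx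
      exact ⟨(Order.succ a).toZFSet,
        Ordinal.toZFSet_mem_toZFSet_iff.2 (Ordinal.isSuccLimit_omega0.succ_lt ha),
        Ordinal.toZFSet_mem_toZFSet_iff.2 (Order.lt_succ a)⟩
  · rintro ⟨w, hw, ⟨x, hx⟩, hs⟩
    refine lt_of_le_of_lt ?_ hw
    have key : ∀ n : ℕ, ∃ y ∈ w, (n : Ordinal) ≤ y.rank := by
      intro n
      induction n with
      | zero => exact ⟨x, hx, by simp⟩
      | succ n ih =>
        obtain ⟨y, hy, hn⟩ := ih
        obtain ⟨z, hz, hyz⟩ := hs y hy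
        refine ⟨z, hz, ?_⟩
        rw [Nat.cast_succ, ← Order.succ_eq_add_one, Order.succ_le_iff]
        exact hn.trans_lt (ZFSet.rank_lt_of_mem hyz)
    rw [Ordinal.omega0_le]
    intro n
    obtain ⟨y, hy, hn⟩ := key n
    exact hn.trans (ZFSet.rank_lt_of_mem hy).le

theorem UDefinable.isInaccOrd {α : Type} (l : α) :
    UDefinable fun _ v => IsInaccOrd (v l).1.rank := by
  have h : UDefinable fun γ v =>
      (∃ w : Vt γ, w.1.rank < (v l).1.rank ∧ (∃ x : Vt γ, x.1 ∈ w.1) ∧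
        ∀ x : Vt γ, x.1 ∈ w.1 → ∃ y : Vt γ, y.1 ∈ w.1 ∧ x.1 ∈ y.1) ∧
      ∀ a : Vt γ, a.1.rank < (v l).1.rank → ∀ R : Vt γ,
        (∀ x y y' : Vt γ, ZFSet.pair x.1 y.1 ∈ R.1 → ZFSet.pair x.1 y'.1 ∈ R.1 → y = y') →
        ∃ b : Vt γ, b.1.rank < (v l).1.rank ∧ ∀ x y : Vt γ, x.1 ∈ a.1 → y.1.rank < (v l).1.rank →
          ZFSet.pair x.1 y.1 ∈ R.1 → y.1.rank < b.1.rank :=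
    .and
      (.ex (.and (.rank_lt _ _) (.and (.ex (.mem _ _))
        (.all (.imp (.mem _ _) (.ex (.and (.mem _ _) (.mem _ _))))))))
      (.all (.imp (.rank_lt _ _) (.all (.imp
        (.all (.all (.all (.imp (.pair_mem _ _ _) (.imp (.pair_mem _ _ _) (.eq _ _))))))
        (.ex (.and (.rank_lt _ _) (.all (.all (.imp (.mem _ _) (.imp (.rank_lt _ _)
          (.imp (.pair_mem _ _ _) (.rank_lt _ _))))))))))))
  refine h.congr fun γ hγ v => ?_
  have hlim := hγ.isSuccLimit
  rw [isInaccOrd_iff, omega_lt_iff]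
  refine and_congr ⟨?_, ?_⟩ ⟨?_, ?_⟩
  · rintro ⟨w, hw, ⟨x, hx⟩, hs⟩
    have hwγ := hw.trans (v l).2
    refine ⟨⟨w, hwγ⟩, hw, ⟨⟨x, (ZFSet.rank_lt_of_mem hx).trans hwγ⟩, hx⟩, fun x hx => ?_⟩
    obtain ⟨y, hy, hxy⟩ := hs x.1 hx
    exact ⟨⟨y, (ZFSet.rank_lt_of_mem hy).trans hwγ⟩, hy, hxy⟩
  · rintro ⟨w, hw, ⟨x, hx⟩, hs⟩
    refine ⟨w.1, hw, ⟨x.1, hx⟩, fun x hx => ?_⟩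
    obtain ⟨y, hy, hxy⟩ := hs ⟨x, rank_lt_of_mem_Vt w hx⟩ hx
    exact ⟨y.1, hy, hxy⟩
  · intro h a ha R hR
    classical
    obtain ⟨β, hβ, hF⟩ := h a.1 ha
      (fun x => if h : ∃ y : Vt γ, y.1.rank < (v l).1.rank ∧ ZFSet.pair x y.1 ∈ R.1
        then h.choose.1.rank else 0) (fun x _ => by
          split_ifs with h
          · exact h.choose_spec.1
          · exact zero_le.trans_lt ha)
    refine ⟨⟨β.toZFSet, by simpa using hβ.trans (v l).2⟩, by simpa using hβ,
      fun x y hx hy hxy => ?_⟩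
    have hex : ∃ y : Vt γ, y.1.rank < (v l).1.rank ∧ ZFSet.pair x.1 y.1 ∈ R.1 := ⟨y, hy, hxy⟩
    have := hF x.1 hx
    rw [dif_pos hex, ← hR x y _ hxy hex.choose_spec.2] at this
    simpa using this
  · intro h a ha F hF
    have haγ := ha.trans (v l).2
    obtain ⟨R, hR⟩ := exists_Vt_mem_iff
      (hlim.succ_lt (hlim.succ_lt (hlim.succ_lt (v l).2)))
      (fun p => ∃ x ∈ a, p = ZFSet.pair x (F x).toZFSet) (by
        rintro _ ⟨x, hx, rfl⟩
        have h1 := ((ZFSet.rank_lt_of_mem hx).trans ha).le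
        have h2 := (hF x hx).le
        simp only [ZFSet.pair, ZFSet.rank_pair, ZFSet.rank_singleton, Ordinal.rank_toZFSet]
        simp [h1, h2])
    obtain ⟨b, hb, hbound⟩ := h ⟨a, haγ⟩ ha R (fun x y y' hy hy' => by
      obtain ⟨x₁, -, h₁⟩ := (hR _).1 hy
      obtain ⟨x₂, -, h₂⟩ := (hR _).1 hy'
      obtain ⟨rfl, e₁⟩ := ZFSet.pair_inj.1 h₁
      obtain ⟨rfl, e₂⟩ := ZFSet.pair_inj.1 h₂
      exact Subtype.ext (e₁.trans e₂.symm))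
    refine ⟨b.1.rank, hb, fun x hx => ?_⟩
    have := hbound ⟨x, (ZFSet.rank_lt_of_mem hx).trans haγ⟩
      ⟨(F x).toZFSet, by simpa using (hF x hx).trans (v l).2⟩ hx (by simpa using hF x hx)
      ((hR _).2 ⟨x, hx, rfl⟩)
    simpa using this

/-! ### A second-order characterization of `V_δ ≺ V_μ` -/

/-- A family of sets of assignments into `V_μ`, with variables indexed by `V_μ`, which is closed
under the operations interpreting the formulas of set theory. -/
structure IsSatFamily (μ : Ordinal) (D : Set (Set (Vt μ → Vt μ))) : Prop where
  mem : ∀ i j : Vt μ, {g | (g i).1 ∈ (g j).1} ∈ D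
  eq : ∀ i j : Vt μ, {g | g i = g j} ∈ D
  empty : ∅ ∈ D
  imp : ∀ S ∈ D, ∀ T ∈ D, {g | g ∈ S → g ∈ T} ∈ D
  all : ∀ S ∈ D, ∀ i : Vt μ, {g | ∀ g', (∀ j, j ≠ i → g' j = g j) → g' ∈ S} ∈ D

/-- The Tarski-Vaught criterion for `V_δ` as a substructure of `V_μ`, relative to a family of sets
of assignments. -/
def TarskiVaught (δ μ : Ordinal) (D : Set (Set (Vt μ → Vt μ))) : Prop :=
  ∀ S ∈ D, ∀ (i : Vt μ) (g : Vt μ → Vt μ), (∀ j, (g j).1.rank < δ) →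
    ∀ g' ∈ S, (∀ j, j ≠ i → g' j = g j) →
      ∃ g'' ∈ S, (∀ j, j ≠ i → g'' j = g j) ∧ ∀ j, (g'' j).1.rank < δ

theorem VElem.le {δ μ : Ordinal} (h : VElem δ μ) : δ ≤ μ := by
  obtain ⟨e, he⟩ := h
  refine le_of_forall_lt fun o ho => ?_
  have h1 := (e ⟨o.toZFSet, by simpa using ho⟩).2
  rw [he] at h1
  simpa using h1

theorem VElem.pos {δ μ : Ordinal} (h : VElem δ μ) (hμ : 0 < μ) : 0 < δ := by
  obtain ⟨e, -⟩ := h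
  have : Nonempty (Vt μ) := ⟨⟨∅, by simpa using hμ⟩⟩
  obtain ⟨x⟩ : Nonempty (Vt δ) := e.elementarilyEquivalent.nonempty_iff.2 this
  exact zero_le.trans_lt x.2

theorem VElem.exists_satFamily {δ μ : Ordinal} (h : VElem δ μ) :
    ∃ D, IsSatFamily μ D ∧ TarskiVaught δ μ D := by
  classical
  obtain ⟨e, he⟩ := h
  have hall : ∀ (φ : LSet.Formula (Vt μ)) (i : Vt μ), ∃ ψ : LSet.Formula (Vt μ),
      ∀ (ν : Ordinal) (g : Vt μ → Vt ν), ψ.Realize g ↔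
        ∀ g', (∀ j, j ≠ i → g' j = g j) → φ.Realize g' := by
    intro φ i
    refine ⟨Formula.iAlls Unit
      (φ.relabel fun j => if j = i then Sum.inr () else Sum.inl j), fun ν g => ?_⟩
    simp only [Formula.realize_iAlls, Formula.realize_relabel]
    constructor
    · intro h g' hg'
      convert! h fun _ => g' i using 1
      funext j
      by_cases hj : j = i
      · simp [hj]
      · simp [hj, hg' j hj]
    · intro h x
      refine h _ fun j hj => ?_
      simp [hj]
  refine ⟨{X | ∃ φ : LSet.Formula (Vt μ), ∀ g, φ.Realize g ↔ g ∈ X}, ⟨?_, ?_, ?_, ?_, ?_⟩, ?_⟩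
  · intro i j
    exact ⟨Relations.formula₂ (L := LSet) adj (Term.var i) (Term.var j), fun g =>
      Formula.realize_rel₂.trans Iff.rfl⟩
  · intro i j
    exact ⟨Term.equal (Term.var i) (Term.var j), fun g => Formula.realize_equal.trans Iff.rfl⟩
  · exact ⟨⊥, fun g => by simp⟩
  · rintro S ⟨φ, hφ⟩ T ⟨ψ, hψ⟩
    exact ⟨φ.imp ψ, fun g => by simp [Formula.realize_imp, hφ, hψ]⟩
  · rintro S ⟨φ, hφ⟩ i
    obtain ⟨ψ, hψ⟩ := hall φ i
    exact ⟨ψ, fun g => by simp [hψ, hφ]⟩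
  · rintro S ⟨φ, hφ⟩ i g hg g' hg' hgg'
    obtain ⟨ψ, hψ⟩ := hall φ.not i
    have hlift : ∀ k : Vt μ → Vt μ, ∀ hk : ∀ j, (k j).1.rank < δ,
        (e ∘ fun j => (⟨(k j).1, hk j⟩ : Vt δ)) = k := fun k hk =>
      funext fun j => Subtype.ext (he _)
    have h1 : ¬ ψ.Realize g := by
      rw [hψ]
      intro h
      exact h g' hgg' ((hφ g').2 hg')
    rw [← hlift g hg, e.map_formula, hψ] at h1
    push Not at h1
    obtain ⟨k, hk, hφk⟩ := h1
    rw [Formula.realize_not, not_not, ← e.map_formula, hφ] at hφk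
    refine ⟨_, hφk, fun j hj => ?_, fun j => ?_⟩
    · refine Subtype.ext ?_
      rw [Function.comp_apply, he, hk j hj]
    · rw [Function.comp_apply, he]
      exact (k j).2

theorem IsSatFamily.realize_mem {μ : Ordinal} {D : Set (Set (Vt μ → Vt μ))} (h : IsSatFamily μ D)
    {ι : ℕ → Vt μ} (hι : Function.Injective ι) {n : ℕ} (φ : LSet.BoundedFormula Empty n) :
    {g : Vt μ → Vt μ | φ.Realize default fun k : Fin n => g (ι k)} ∈ D := by
  induction φ with
  | falsum => exact h.empty
  | @equal n t₁ t₂ =>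
    rcases t₁ with (x | i) | ⟨⟨⟩⟩
    · exact x.elim
    rcases t₂ with (x | j) | ⟨⟨⟩⟩
    · exact x.elim
    exact h.eq (ι i) (ι j)
  | @rel n l R ts =>
    obtain ⟨⟩ := R
    rcases h0 : ts 0 with (x | i) | ⟨⟨⟩⟩
    · exact x.elim
    rcases h1 : ts 1 with (x | j) | ⟨⟨⟩⟩
    · exact x.elim
    convert! h.mem (ι i) (ι j) using 2
    ext g
    change (Term.realize (M := Vt μ) (Sum.elim default fun k : Fin n => g (ι k)) (ts 0)).1 ∈
      (Term.realize (M := Vt μ) (Sum.elim default fun k : Fin n => g (ι k)) (ts 1)).1 ↔ _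
    rw [h0, h1]
    rfl
  | imp φ ψ ihφ ihψ => exact h.imp _ ihφ _ ihψ
  | @all n φ ih =>
    convert! h.all _ ih (ι n) using 1
    ext g
    simp only [BoundedFormula.realize_all, Set.mem_ofPred_eq]
    constructor
    · intro hg g' hgg'
      convert! hg (g' (ι n)) using 1
      funext k
      refine Fin.lastCases ?_ (fun k => ?_) k
      · simp
      · simp only [Fin.snoc_castSucc, Fin.val_castSucc]
        exact hgg' _ fun hk => k.2.ne (hι hk)
    · intro hg a
      classical
      convert! hg (Function.update g (ι n) a) fun j hj => Function.update_of_ne hj _ _ using 1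
      funext k
      refine Fin.lastCases ?_ (fun k => ?_) k
      · simp
      · simp only [Fin.snoc_castSucc, Fin.val_castSucc]
        rw [Function.update_of_ne fun hk => k.2.ne (hι hk)]

theorem velem_of_satFamily {δ μ : Ordinal} (hμ : Ordinal.omega0 ≤ μ) (hδ : 0 < δ) (hle : δ ≤ μ)
    {D : Set (Set (Vt μ → Vt μ))} (hD : IsSatFamily μ D) (hTV : TarskiVaught δ μ D) :
    VElem δ μ := by
  classical
  let ι : ℕ → Vt μ := fun n => ⟨(n : Ordinal).toZFSet, by
    rw [Ordinal.rank_toZFSet]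
    exact (Ordinal.natCast_lt_omega0 n).trans_le hμ⟩
  have hι : Function.Injective ι := fun m n hmn =>
    Nat.cast_injective (R := Ordinal) (Ordinal.toZFSet_injective (congrArg Subtype.val hmn))
  let f : Vt δ ↪[LSet] Vt μ :=
    { toFun := fun x => ⟨x.1, x.2.trans_le hle⟩
      inj' := fun x y hxy => Subtype.ext (Subtype.mk.inj hxy)
      map_fun' := fun F => F.elim
      map_rel' := fun R x => by cases R; exact Iff.rfl }
  refine ⟨f.toElementaryEmbedding fun n φ x a hφ => ?_, fun x => rfl⟩
  let z : Vt δ := ⟨∅, by simpa using hδ⟩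
  let g : Vt μ → Vt μ := fun j => if h : ∃ k : Fin n, ι k = j then f (x h.choose) else f z
  have hg : ∀ k : Fin n, g (ι k) = f (x k) := fun k => by
    have hex : ∃ k' : Fin n, ι k' = ι k := ⟨k, rfl⟩
    simp only [g, dif_pos hex]
    rw [Fin.val_injective (hι hex.choose_spec)]
  have hgδ : ∀ j, (g j).1.rank < δ := fun j => by
    simp only [g]
    split_ifs
    · exact (x _).2
    · exact z.2
  have hsnoc : ∀ g' : Vt μ → Vt μ, (∀ j, j ≠ ι n → g' j = g j) →
      (fun k : Fin (n + 1) => g' (ι k)) = Fin.snoc (f ∘ x) (g' (ι n)) := fun g' hg' => by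
    funext k
    refine Fin.lastCases ?_ (fun k => ?_) k
    · simp
    · simp only [Fin.snoc_castSucc, Fin.val_castSucc, Function.comp_apply]
      rw [hg' _ fun hk => k.2.ne (hι hk), hg]
  obtain ⟨g'', hmem, hagree, hrank⟩ := hTV _ (hD.realize_mem hι φ) (ι n) g hgδ
    (Function.update g (ι n) a) (by
      rw [Set.mem_ofPred_eq, hsnoc _ fun j hj => Function.update_of_ne hj _ _]
      simpa using hφ) fun j hj => Function.update_of_ne hj _ _
  rw [Set.mem_ofPred_eq, hsnoc _ hagree] at hmem
  exact ⟨⟨(g'' (ι n)).1, hrank _⟩, hmem⟩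

/-! ### Definability of elementarity -/

/-- The graph of a map `V_μ → V_μ`, as a set. -/
noncomputable def graphSet {μ : Ordinal} (g : Vt μ → Vt μ) : ZFSet :=
  ZFSet.sep (fun p => ∃ i : Vt μ, p = ZFSet.pair i.1 (g i).1)
    (ZFSet.prod (ZFSet.vonNeumann μ) (ZFSet.vonNeumann μ))

theorem mem_graphSet {μ : Ordinal} {g : Vt μ → Vt μ} {p : ZFSet} :
    p ∈ graphSet g ↔ ∃ i : Vt μ, p = ZFSet.pair i.1 (g i).1 := by
  rw [graphSet, ZFSet.mem_sep, and_iff_right_iff_imp]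
  rintro ⟨i, rfl⟩
  simpa [ZFSet.mem_vonNeumann] using ⟨i.2, (g i).2⟩

theorem pair_mem_graphSet {μ : Ordinal} {g : Vt μ → Vt μ} {i : Vt μ} {y : ZFSet} :
    ZFSet.pair i.1 y ∈ graphSet g ↔ y = (g i).1 := by
  rw [mem_graphSet]
  constructor
  · rintro ⟨j, hj⟩
    obtain ⟨h1, h2⟩ := ZFSet.pair_inj.1 hj
    rw [h2, Subtype.ext h1]
  · rintro rfl
    exact ⟨i, rfl⟩

theorem graphSet_injective {μ : Ordinal} : Function.Injective (graphSet (μ := μ)) := by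
  intro g g' h
  funext i
  refine Subtype.ext (pair_mem_graphSet.1 ?_)
  rw [← h]
  exact pair_mem_graphSet.2 rfl

theorem rank_graphSet_le {μ : Ordinal} (g : Vt μ → Vt μ) :
    (graphSet g).rank ≤ Order.succ (Order.succ μ) := by
  refine ZFSet.rank_le_iff.2 fun p hp => ?_
  obtain ⟨i, rfl⟩ := mem_graphSet.1 hp
  simp only [ZFSet.pair, ZFSet.rank_pair, ZFSet.rank_singleton]
  simp [i.2, (g i).2]

/-- The graph of a map `V_μ → V_μ`, as an element of a level `V_γ` above. -/
noncomputable def graphIn {γ μ : Ordinal} (hγ : IsInaccOrd γ) (hμ : μ < γ) (g : Vt μ → Vt μ) :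
    Vt γ :=
  ⟨graphSet g, (rank_graphSet_le g).trans_lt
    (hγ.isSuccLimit.succ_lt (hγ.isSuccLimit.succ_lt hμ))⟩

theorem UDefinable.isGraph {α : Type} (l s : α) :
    UDefinable fun _ v => ∃ g : Vt (v l).1.rank → Vt (v l).1.rank, (v s).1 = graphSet g := by
  have h : UDefinable fun γ v =>
      (∀ p : Vt γ, p.1 ∈ (v s).1 → ∃ x y : Vt γ, x.1.rank < (v l).1.rank ∧
        y.1.rank < (v l).1.rank ∧ p.1 = ZFSet.pair x.1 y.1) ∧
      ∀ x : Vt γ, x.1.rank < (v l).1.rank → ∃ y : Vt γ, ∀ z : Vt γ,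
        ZFSet.pair x.1 z.1 ∈ (v s).1 ↔ z = y :=
    .and (.all (.imp (.mem _ _) (.ex (.ex (.and (.rank_lt _ _)
        (.and (.rank_lt _ _) (.eq_pair _ _ _)))))))
      (.all (.imp (.rank_lt _ _) (.ex (.all (.iff (.pair_mem _ _ _) (.eq _ _))))))
  refine h.congr fun γ hγ v => ⟨?_, ?_⟩
  · rintro ⟨g, hg⟩
    have hl := (v l).2
    rw [hg]
    refine ⟨fun p hp => ?_, fun x hx => ⟨⟨(g ⟨x.1, hx⟩).1, (g ⟨x.1, hx⟩).2.trans hl⟩, fun z => ?_⟩⟩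
    · obtain ⟨i, hi⟩ := mem_graphSet.1 hp
      exact ⟨⟨i.1, i.2.trans hl⟩, ⟨(g i).1, (g i).2.trans hl⟩, i.2, (g i).2, hi⟩
    · rw [Subtype.ext_iff]
      exact pair_mem_graphSet (i := ⟨x.1, hx⟩)
  · rintro ⟨hs, hf⟩
    choose f hf using hf
    have hfs : ∀ x hx, ZFSet.pair x.1 (f x hx).1 ∈ (v s).1 := fun x hx => (hf x hx _).2 rfl
    have hr : ∀ x hx, (f x hx).1.rank < (v l).1.rank := fun x hx => by
      obtain ⟨x', y', -, hy, he⟩ := hs ⟨_, rank_lt_of_mem_Vt _ (hfs x hx)⟩ (hfs x hx)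
      rwa [(ZFSet.pair_inj.1 he).2]
    refine ⟨fun i => ⟨(f ⟨i.1, i.2.trans (v l).2⟩ i.2).1, hr _ _⟩, ZFSet.ext fun p => ?_⟩
    rw [mem_graphSet]
    constructor
    · intro hp
      obtain ⟨x, y, hx, hy, he⟩ := hs ⟨p, rank_lt_of_mem_Vt _ hp⟩ hp
      dsimp only at he
      subst he
      refine ⟨⟨x.1, hx⟩, ?_⟩
      rw [(hf x hx y).1 hp]
    · rintro ⟨i, rfl⟩
      exact hfs _ _

/-- The family of sets of assignments coded by a set of sets of graphs. -/
def decodeFam (μ : Ordinal) (D : ZFSet) : Set (Set (Vt μ → Vt μ)) :=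
  {X | ∃ S ∈ D, ∀ g, graphSet g ∈ S ↔ g ∈ X}

theorem exists_decodeFam_eq {γ μ : Ordinal} (hγ : IsInaccOrd γ) (hμ : μ < γ)
    (E : Set (Set (Vt μ → Vt μ))) : ∃ D : Vt γ, decodeFam μ D.1 = E := by
  have hlim := hγ.isSuccLimit
  have hμ3 : Order.succ (Order.succ (Order.succ μ)) < γ :=
    hlim.succ_lt (hlim.succ_lt (hlim.succ_lt hμ))
  have hcode : ∀ X : Set (Vt μ → Vt μ),
      ∃ S : Vt (Order.succ (Order.succ (Order.succ (Order.succ μ)))),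
        ∀ x, x ∈ S.1 ↔ ∃ g ∈ X, x = graphSet g := fun X => by
    refine exists_Vt_mem_iff (Order.lt_succ _) _ ?_
    rintro _ ⟨g, -, rfl⟩
    exact Order.lt_succ_iff.2 (rank_graphSet_le g)
  choose code hcode using hcode
  have hmem : ∀ X g, graphSet g ∈ (code X).1 ↔ g ∈ X := fun X g => by
    rw [hcode]
    constructor
    · rintro ⟨g', hg', h⟩
      rwa [graphSet_injective h]
    · exact fun h => ⟨g, h, rfl⟩
  obtain ⟨D, hD⟩ := exists_Vt_mem_iff (hlim.succ_lt hμ3) (fun x => ∃ X ∈ E, x = (code X).1) (by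
    rintro _ ⟨X, -, rfl⟩
    exact (code X).2)
  refine ⟨D, Set.ext fun X => ⟨?_, fun hX => ⟨_, (hD _).2 ⟨X, hX, rfl⟩, hmem X⟩⟩⟩
  rintro ⟨S, hS, hSX⟩
  obtain ⟨Y, hY, rfl⟩ := (hD _).1 hS
  rwa [← Set.ext fun g => (hmem Y g).symm.trans (hSX g)]

theorem forall_isGraph {γ μ : Ordinal} (hγ : IsInaccOrd γ) (hμ : μ < γ) {P : Vt γ → Prop} :
    (∀ s : Vt γ, (∃ g : Vt μ → Vt μ, s.1 = graphSet g) → P s) ↔ ∀ g, P (graphIn hγ hμ g) := by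
  refine ⟨fun h g => h _ ⟨g, rfl⟩, ?_⟩
  rintro h s ⟨g, hg⟩
  rw [show s = graphIn hγ hμ g from Subtype.ext hg]
  exact h g

theorem exists_isGraph {γ μ : Ordinal} (hγ : IsInaccOrd γ) (hμ : μ < γ) {P : Vt γ → Prop} :
    (∃ s : Vt γ, (∃ g : Vt μ → Vt μ, s.1 = graphSet g) ∧ P s) ↔ ∃ g, P (graphIn hγ hμ g) := by
  simpa using (forall_isGraph hγ hμ (P := fun s => ¬ P s)).not

theorem forall_rank_lt {γ μ : Ordinal} (hμ : μ < γ) {P : Vt γ → Prop} :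
    (∀ i : Vt γ, i.1.rank < μ → P i) ↔ ∀ i : Vt μ, P ⟨i.1, i.2.trans hμ⟩ :=
  ⟨fun h i => h _ i.2, fun h i hi => h ⟨i.1, hi⟩⟩

theorem forall_mem_decodeFam {γ μ : Ordinal} {D : Vt γ} {P : Set (Vt μ → Vt μ) → Prop} :
    (∀ X ∈ decodeFam μ D.1, P X) ↔ ∀ S : Vt γ, S.1 ∈ D.1 → P {g | graphSet g ∈ S.1} := by
  refine ⟨fun h S hS => h _ ⟨S.1, hS, fun g => Iff.rfl⟩, ?_⟩
  rintro h X ⟨S, hS, hSX⟩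
  rw [← Set.ext hSX]
  exact h ⟨S, rank_lt_of_mem_Vt D hS⟩ hS

theorem exists_mem_iff_setOf_mem_decodeFam {γ μ : Ordinal} (hγ : IsInaccOrd γ) (hμ : μ < γ)
    {D : Vt γ} {P : Vt γ → Prop} :
    (∃ S : Vt γ, S.1 ∈ D.1 ∧ ∀ s : Vt γ, (∃ g : Vt μ → Vt μ, s.1 = graphSet g) →
      (s.1 ∈ S.1 ↔ P s)) ↔ {g | P (graphIn hγ hμ g)} ∈ decodeFam μ D.1 := by
  simp only [forall_isGraph hγ hμ]
  refine ⟨fun ⟨S, hS, h⟩ => ⟨S.1, hS, h⟩, fun ⟨S, hS, h⟩ => ⟨⟨S, rank_lt_of_mem_Vt D hS⟩, hS, h⟩⟩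

theorem agree_iff {γ μ : Ordinal} (hγ : IsInaccOrd γ) (hμ : μ < γ) {g g' : Vt μ → Vt μ}
    {i : Vt μ} :
    (∀ j : Vt γ, j.1.rank < μ → ∀ y : Vt γ, j ≠ ⟨i.1, i.2.trans hμ⟩ →
      ZFSet.pair j.1 y.1 ∈ (graphIn hγ hμ g').1 → ZFSet.pair j.1 y.1 ∈ (graphIn hγ hμ g).1) ↔
      ∀ j, j ≠ i → g' j = g j := by
  rw [forall_rank_lt hμ]
  simp only [graphIn, pair_mem_graphSet, ne_eq, Subtype.mk.injEq, Subtype.coe_inj]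
  refine forall_congr' fun j => ⟨fun h hj => ?_, fun h y hj hy => ?_⟩
  · exact Subtype.ext (h ⟨(g' j).1, (g' j).2.trans hμ⟩ hj rfl)
  · rw [hy, h hj]

theorem values_iff {γ μ δ : Ordinal} (hγ : IsInaccOrd γ) (hμ : μ < γ) {g : Vt μ → Vt μ} :
    (∀ j : Vt γ, j.1.rank < μ → ∀ y : Vt γ, ZFSet.pair j.1 y.1 ∈ (graphIn hγ hμ g).1 →
      y.1.rank < δ) ↔ ∀ j, (g j).1.rank < δ := by
  rw [forall_rank_lt hμ]
  simp only [graphIn, pair_mem_graphSet]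
  refine forall_congr' fun j => ⟨fun h => ?_, fun h y hy => ?_⟩
  · exact h ⟨(g j).1, (g j).2.trans hμ⟩ rfl
  · rwa [hy]

theorem UDefinable.agree {α : Type} (l i s s' : α) :
    UDefinable fun γ v => ∀ j : Vt γ, j.1.rank < (v l).1.rank → ∀ y : Vt γ, j ≠ v i →
      ZFSet.pair j.1 y.1 ∈ (v s').1 → ZFSet.pair j.1 y.1 ∈ (v s).1 :=
  .all (.imp (.rank_lt _ _) (.all (.imp (.not (.eq _ _))
    (.imp (.pair_mem _ _ _) (.pair_mem _ _ _)))))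

theorem UDefinable.values {α : Type} (l d s : α) :
    UDefinable fun γ v => ∀ j : Vt γ, j.1.rank < (v l).1.rank → ∀ y : Vt γ,
      ZFSet.pair j.1 y.1 ∈ (v s).1 → y.1.rank < (v d).1.rank :=
  .all (.imp (.rank_lt _ _) (.all (.imp (.pair_mem _ _ _) (.rank_lt _ _))))

theorem UDefinable.mem_decodeFam {α : Type} (l D : α) {P : ∀ γ : Ordinal, (α → Vt γ) → Vt γ → Prop}
    (h : UDefinable fun γ (w : Option α → Vt γ) => P γ (fun a => w (some a)) (w none)) :
    UDefinable fun γ v => ∃ S : Vt γ, S.1 ∈ (v D).1 ∧ ∀ s : Vt γ,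
      (∃ g : Vt (v l).1.rank → Vt (v l).1.rank, s.1 = graphSet g) → (s.1 ∈ S.1 ↔ P γ v s) :=
  .ex (.and (.mem _ _) (.all (.imp (.isGraph (some (some l)) none) (.iff (.mem none (some none))
    (h.comap fun o => o.elim none fun a => some (some a))))))

theorem UDefinable.isSatFamily {α : Type} (l D : α) :
    UDefinable fun _ v => IsSatFamily (v l).1.rank (decodeFam (v l).1.rank (v D).1) := by
  have hmem : UDefinable fun γ v => ∀ i : Vt γ, i.1.rank < (v l).1.rank → ∀ j : Vt γ,
      j.1.rank < (v l).1.rank → ∃ S : Vt γ, S.1 ∈ (v D).1 ∧ ∀ s : Vt γ,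
        (∃ g : Vt (v l).1.rank → Vt (v l).1.rank, s.1 = graphSet g) → (s.1 ∈ S.1 ↔
          ∃ x y : Vt γ, ZFSet.pair i.1 x.1 ∈ s.1 ∧ ZFSet.pair j.1 y.1 ∈ s.1 ∧ x.1 ∈ y.1) :=
    .all (.imp (.rank_lt _ _) (.all (.imp (.rank_lt _ _) (.mem_decodeFam _ _ (.ex (.ex
      (.and (.pair_mem _ _ _) (.and (.pair_mem _ _ _) (.mem _ _)))))))))
  have heq : UDefinable fun γ v => ∀ i : Vt γ, i.1.rank < (v l).1.rank → ∀ j : Vt γ,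
      j.1.rank < (v l).1.rank → ∃ S : Vt γ, S.1 ∈ (v D).1 ∧ ∀ s : Vt γ,
        (∃ g : Vt (v l).1.rank → Vt (v l).1.rank, s.1 = graphSet g) → (s.1 ∈ S.1 ↔
          ∃ x y : Vt γ, ZFSet.pair i.1 x.1 ∈ s.1 ∧ ZFSet.pair j.1 y.1 ∈ s.1 ∧ x = y) :=
    .all (.imp (.rank_lt _ _) (.all (.imp (.rank_lt _ _) (.mem_decodeFam _ _ (.ex (.ex
      (.and (.pair_mem _ _ _) (.and (.pair_mem _ _ _) (.eq _ _)))))))))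
  have hempty : UDefinable fun γ v => ∃ S : Vt γ, S.1 ∈ (v D).1 ∧ ∀ s : Vt γ,
      (∃ g : Vt (v l).1.rank → Vt (v l).1.rank, s.1 = graphSet g) → (s.1 ∈ S.1 ↔ s ≠ s) :=
    .mem_decodeFam _ _ (.not (.eq _ _))
  have himp : UDefinable fun γ v => ∀ S : Vt γ, S.1 ∈ (v D).1 → ∀ T : Vt γ, T.1 ∈ (v D).1 →
      ∃ U : Vt γ, U.1 ∈ (v D).1 ∧ ∀ s : Vt γ,
        (∃ g : Vt (v l).1.rank → Vt (v l).1.rank, s.1 = graphSet g) →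
          (s.1 ∈ U.1 ↔ (s.1 ∈ S.1 → s.1 ∈ T.1)) :=
    .all (.imp (.mem _ _) (.all (.imp (.mem _ _) (.mem_decodeFam _ _ (.imp (.mem _ _)
      (.mem _ _))))))
  have hall : UDefinable fun γ v => ∀ S : Vt γ, S.1 ∈ (v D).1 → ∀ i : Vt γ,
      i.1.rank < (v l).1.rank → ∃ U : Vt γ, U.1 ∈ (v D).1 ∧ ∀ s : Vt γ,
        (∃ g : Vt (v l).1.rank → Vt (v l).1.rank, s.1 = graphSet g) → (s.1 ∈ U.1 ↔
          ∀ s' : Vt γ, (∃ g : Vt (v l).1.rank → Vt (v l).1.rank, s'.1 = graphSet g) →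
            (∀ j : Vt γ, j.1.rank < (v l).1.rank → ∀ y : Vt γ, j ≠ i →
              ZFSet.pair j.1 y.1 ∈ s'.1 → ZFSet.pair j.1 y.1 ∈ s.1) → s'.1 ∈ S.1) :=
    .all (.imp (.mem _ _) (.all (.imp (.rank_lt _ _) (.mem_decodeFam _ _ (.all (.imp
      (.isGraph (some (some (some (some l)))) none) (.imp (.agree _ _ _ _) (.mem _ _))))))))
  refine (hmem.and (heq.and (hempty.and (himp.and hall)))).congr fun γ hγ v => ?_
  have hμ := (v l).2
  have happ : ∀ (g : Vt (v l).1.rank → Vt (v l).1.rank) (i j : Vt (v l).1.rank)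
      (R : Vt γ → Vt γ → Prop), (∃ x y : Vt γ, ZFSet.pair i.1 x.1 ∈ (graphIn hγ hμ g).1 ∧
        ZFSet.pair j.1 y.1 ∈ (graphIn hγ hμ g).1 ∧ R x y) ↔
      R ⟨(g i).1, (g i).2.trans hμ⟩ ⟨(g j).1, (g j).2.trans hμ⟩ := fun g i j R => by
    simp only [graphIn, pair_mem_graphSet]
    constructor
    · rintro ⟨⟨x, hx⟩, ⟨y, hy⟩, rfl, rfl, h⟩
      exact h
    · exact fun h => ⟨_, _, rfl, rfl, h⟩
  have hset : ∀ {P : Vt γ → Prop} {Q : (Vt (v l).1.rank → Vt (v l).1.rank) → Prop},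
      (∀ g, P (graphIn hγ hμ g) ↔ Q g) →
      ({g | Q g} ∈ decodeFam (v l).1.rank (v D).1 ↔ ∃ S : Vt γ, S.1 ∈ (v D).1 ∧ ∀ s : Vt γ,
        (∃ g : Vt (v l).1.rank → Vt (v l).1.rank, s.1 = graphSet g) → (s.1 ∈ S.1 ↔ P s)) :=
    fun {P Q} h => by
      rw [exists_mem_iff_setOf_mem_decodeFam hγ hμ]
      simp only [h]
  have hstruct : ∀ {μ : Ordinal} {E : Set (Set (Vt μ → Vt μ))}, IsSatFamily μ E ↔
      (∀ i j : Vt μ, {g | (g i).1 ∈ (g j).1} ∈ E) ∧ (∀ i j : Vt μ, {g | g i = g j} ∈ E) ∧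
      {g | False} ∈ E ∧ (∀ S ∈ E, ∀ T ∈ E, {g | g ∈ S → g ∈ T} ∈ E) ∧
      ∀ S ∈ E, ∀ i : Vt μ, {g | ∀ g', (∀ j, j ≠ i → g' j = g j) → g' ∈ S} ∈ E :=
    ⟨fun h => ⟨h.mem, h.eq, h.empty, h.imp, h.all⟩,
      fun ⟨h1, h2, h3, h4, h5⟩ => ⟨h1, h2, h3, h4, h5⟩⟩
  rw [hstruct]
  refine and_congr ?_ (and_congr ?_ (and_congr ?_ (and_congr ?_ ?_)))
  · rw [forall_rank_lt hμ]
    refine forall_congr' fun i => ?_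
    rw [forall_rank_lt hμ]
    exact forall_congr' fun j => hset fun g => happ g i j fun x y => x.1 ∈ y.1
  · rw [forall_rank_lt hμ]
    refine forall_congr' fun i => ?_
    rw [forall_rank_lt hμ]
    refine forall_congr' fun j => hset fun g => (happ g i j fun x y => x = y).trans ?_
    simp only [Subtype.ext_iff]
  · exact hset fun g => by simp
  · rw [forall_mem_decodeFam]
    refine forall₂_congr fun S hS => ?_
    rw [forall_mem_decodeFam]
    exact forall₂_congr fun T hT => hset fun g => Iff.rfl
  · rw [forall_mem_decodeFam]
    refine forall₂_congr fun S hS => ?_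
    rw [forall_rank_lt hμ]
    refine forall_congr' fun i => hset fun g => ?_
    rw [forall_isGraph hγ hμ]
    exact forall_congr' fun g' => imp_congr (agree_iff hγ hμ) Iff.rfl

theorem UDefinable.tarskiVaught {α : Type} (d l D : α) :
    UDefinable fun _ v =>
      TarskiVaught (v d).1.rank (v l).1.rank (decodeFam (v l).1.rank (v D).1) := by
  have h : UDefinable fun γ v => ∀ S : Vt γ, S.1 ∈ (v D).1 → ∀ i : Vt γ,
      i.1.rank < (v l).1.rank → ∀ s : Vt γ,
      (∃ g : Vt (v l).1.rank → Vt (v l).1.rank, s.1 = graphSet g) →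
      (∀ j : Vt γ, j.1.rank < (v l).1.rank → ∀ y : Vt γ,
        ZFSet.pair j.1 y.1 ∈ s.1 → y.1.rank < (v d).1.rank) →
      ∀ s' : Vt γ, (∃ g : Vt (v l).1.rank → Vt (v l).1.rank, s'.1 = graphSet g) →
      s'.1 ∈ S.1 → (∀ j : Vt γ, j.1.rank < (v l).1.rank → ∀ y : Vt γ, j ≠ i →
        ZFSet.pair j.1 y.1 ∈ s'.1 → ZFSet.pair j.1 y.1 ∈ s.1) →
      ∃ t : Vt γ, (∃ g : Vt (v l).1.rank → Vt (v l).1.rank, t.1 = graphSet g) ∧ t.1 ∈ S.1 ∧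
        (∀ j : Vt γ, j.1.rank < (v l).1.rank → ∀ y : Vt γ, j ≠ i →
          ZFSet.pair j.1 y.1 ∈ t.1 → ZFSet.pair j.1 y.1 ∈ s.1) ∧
        ∀ j : Vt γ, j.1.rank < (v l).1.rank → ∀ y : Vt γ,
          ZFSet.pair j.1 y.1 ∈ t.1 → y.1.rank < (v d).1.rank :=
    .all (.imp (.mem _ _) (.all (.imp (.rank_lt _ _) (.all (.imp
      (.isGraph (some (some (some l))) none) (.imp (.values _ _ _) (.all (.imp
        (.isGraph (some (some (some (some l)))) none) (.imp (.mem _ _) (.imp (.agree _ _ _ _) (.ex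
          (.and (.isGraph (some (some (some (some (some l))))) none) (.and (.mem _ _)
            (.and (.agree _ _ _ _) (.values _ _ _)))))))))))))))
  refine h.congr fun γ hγ v => ?_
  have hμ := (v l).2
  rw [TarskiVaught, forall_mem_decodeFam]
  refine forall₂_congr fun S hS => ?_
  rw [forall_rank_lt hμ]
  refine forall_congr' fun i => ?_
  rw [forall_isGraph hγ hμ]
  refine forall_congr' fun g => imp_congr (values_iff hγ hμ).symm ?_
  rw [forall_isGraph hγ hμ]
  refine forall_congr' fun g' => imp_congr Iff.rfl (imp_congr (agree_iff hγ hμ).symm ?_)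
  rw [exists_isGraph hγ hμ]
  exact exists_congr fun t => and_congr Iff.rfl
    (and_congr (agree_iff hγ hμ).symm (values_iff hγ hμ).symm)

/-- Elementarity of `V_δ` in `V_μ` at inaccessible `μ` is uniformly definable. -/
theorem UDefinable.velem {α : Type} (d l : α) :
    UDefinable fun _ v => IsInaccOrd (v l).1.rank ∧ VElem (v d).1.rank (v l).1.rank := by
  have h : UDefinable fun γ v => IsInaccOrd (v l).1.rank ∧
      (∃ x : Vt γ, x.1.rank < (v d).1.rank) ∧ (v d).1.rank ≤ (v l).1.rank ∧
      ∃ D : Vt γ, IsSatFamily (v l).1.rank (decodeFam (v l).1.rank D.1) ∧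
        TarskiVaught (v d).1.rank (v l).1.rank (decodeFam (v l).1.rank D.1) :=
    .and (.isInaccOrd _) (.and (.ex (.rank_lt _ _)) (.and (.rank_le _ _) (.ex
      (.and (.isSatFamily (some l) none) (.tarskiVaught (some d) (some l) none)))))
  refine h.congr fun γ hγ v => and_congr_right fun hl => ⟨fun h => ?_, ?_⟩
  · obtain ⟨E, hE, hTV⟩ := h.exists_satFamily
    obtain ⟨D, rfl⟩ := exists_decodeFam_eq hγ (v l).2 E
    exact ⟨⟨⟨∅, by simpa using hγ.pos⟩, by simpa using h.pos hl.pos⟩, h.le, D, hE, hTV⟩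
  · rintro ⟨⟨x, hx⟩, hle, D, hD, hTV⟩
    exact velem_of_satFamily hl.omega_lt.le (zero_le.trans_lt hx) hle hD hTV

/-! ### The failure-of-upliftingness function inside a level -/

open Classical in
/-- The failure-of-upliftingness function as computed in `V_γ`, with value `0` at those `δ` for
which the inaccessible `μ < γ` with `V_δ ≺ V_μ` are unbounded in `γ`. -/
noncomputable def localFailUplift (γ δ : Ordinal) : Ordinal :=
  if ∃ b < γ, ∀ μ < γ, IsInaccOrd μ ∧ VElem δ μ → μ ≤ b then
    sSup {μ | μ < γ ∧ IsInaccOrd μ ∧ VElem δ μ}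
  else 0

theorem localFailUplift_le_iff {γ δ b z : Ordinal} (hb : b < γ)
    (h : ∀ μ < γ, IsInaccOrd μ ∧ VElem δ μ → μ ≤ b) :
    localFailUplift γ δ ≤ z ↔ ∀ μ < γ, IsInaccOrd μ ∧ VElem δ μ → μ ≤ z := by
  have hbdd : BddAbove {μ | μ < γ ∧ IsInaccOrd μ ∧ VElem δ μ} := ⟨b, fun μ hμ => h μ hμ.1 hμ.2⟩
  rw [localFailUplift, if_pos ⟨b, hb, h⟩, csSup_le_iff' hbdd]
  exact ⟨fun h μ h1 h2 => h μ ⟨h1, h2⟩, fun h μ hμ => h μ hμ.1 hμ.2⟩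

theorem localFailUplift_lt {γ : Ordinal} (hγ : 0 < γ) (δ : Ordinal) : localFailUplift γ δ < γ := by
  by_cases h : ∃ b < γ, ∀ μ < γ, IsInaccOrd μ ∧ VElem δ μ → μ ≤ b
  · obtain ⟨b, hb, h⟩ := h
    exact ((localFailUplift_le_iff hb h).2 h).trans_lt hb
  · rwa [localFailUplift, if_neg h]

theorem forall_Vt_rank {γ : Ordinal} {P : Ordinal → Prop} :
    (∀ x : Vt γ, P x.1.rank) ↔ ∀ μ < γ, P μ :=
  ⟨fun h μ hμ => by simpa using h ⟨μ.toZFSet, by simpa using hμ⟩, fun h x => h _ x.2⟩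

theorem exists_Vt_rank {γ : Ordinal} {P : Ordinal → Prop} :
    (∃ x : Vt γ, P x.1.rank) ↔ ∃ μ < γ, P μ := by
  simpa using (forall_Vt_rank (γ := γ) (P := fun μ => ¬ P μ)).not

theorem UDefinable.rank_eq_localFailUplift {α : Type} (x y : α) :
    UDefinable fun γ v => (v y).1.rank = localFailUplift γ (v x).1.rank := by
  have hbdd : UDefinable fun γ v => ∃ b : Vt γ, ∀ m : Vt γ,
      IsInaccOrd m.1.rank ∧ VElem (v x).1.rank m.1.rank → m.1.rank ≤ b.1.rank :=
    .ex (.all (.imp (.velem (some (some x)) none) (.rank_le _ _)))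
  have hsup : UDefinable fun γ v => ∀ z : Vt γ, (∀ m : Vt γ,
      IsInaccOrd m.1.rank ∧ VElem (v x).1.rank m.1.rank → m.1.rank ≤ z.1.rank) ↔
        (v y).1.rank ≤ z.1.rank :=
    .all (.iff (.all (.imp (.velem (some (some x)) none) (.rank_le _ _))) (.rank_le _ _))
  have hzero : UDefinable fun γ v => ∀ z : Vt γ, (v y).1.rank ≤ z.1.rank := .all (.rank_le _ _)
  refine ((hbdd.and hsup).or (hbdd.not.and hzero)).congr fun γ hγ v => ?_
  have hall : ∀ z : Ordinal, (∀ m : Vt γ, IsInaccOrd m.1.rank ∧ VElem (v x).1.rank m.1.rank →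
      m.1.rank ≤ z) ↔ ∀ μ < γ, IsInaccOrd μ ∧ VElem (v x).1.rank μ → μ ≤ z := fun z =>
    forall_Vt_rank (P := fun μ => IsInaccOrd μ ∧ VElem (v x).1.rank μ → μ ≤ z)
  simp only [hall]
  rw [exists_Vt_rank (P := fun b => ∀ μ < γ, IsInaccOrd μ ∧ VElem (v x).1.rank μ → μ ≤ b),
    forall_Vt_rank (P := fun z => (v y).1.rank ≤ z), forall_Vt_rank (P := fun z =>
      (∀ μ < γ, IsInaccOrd μ ∧ VElem (v x).1.rank μ → μ ≤ z) ↔ (v y).1.rank ≤ z)]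
  by_cases h : ∃ b < γ, ∀ μ < γ, IsInaccOrd μ ∧ VElem (v x).1.rank μ → μ ≤ b
  · simp only [h, true_and, not_true_eq_false, false_and, or_false]
    obtain ⟨b, hb, h⟩ := h
    simp only [← localFailUplift_le_iff hb h]
    refine ⟨fun h z _ => by rw [h], fun h => le_antisymm ?_ ((h _ (v y).2).2 le_rfl)⟩
    exact (h _ (localFailUplift_lt hγ.pos _)).1 le_rfl
  · simp only [h, false_and, not_false_eq_true, true_and, false_or]
    rw [localFailUplift, if_neg h]
    exact ⟨fun h z _ => h.trans_le zero_le, fun h => le_antisymm (h 0 hγ.pos) zero_le⟩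

theorem UDefinable.isOrdinal {α : Type} (x : α) : UDefinable fun _ v => (v x).1.IsOrdinal := by
  have h : UDefinable fun γ v =>
      (∀ y : Vt γ, y.1 ∈ (v x).1 → ∀ z : Vt γ, z.1 ∈ y.1 → z.1 ∈ (v x).1) ∧
      ∀ w : Vt γ, w.1 ∈ (v x).1 → ∀ z : Vt γ, z.1 ∈ w.1 → ∀ y : Vt γ, y.1 ∈ z.1 → y.1 ∈ w.1 :=
    .and (.all (.imp (.mem _ _) (.all (.imp (.mem _ _) (.mem _ _)))))
      (.all (.imp (.mem _ _) (.all (.imp (.mem _ _) (.all (.imp (.mem _ _) (.mem _ _)))))))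
  refine h.congr fun γ hγ v => ⟨fun h => ⟨fun y hy z hz => h.1 _ hy hz,
    fun w hw z hz y hy => h.2 hy hz hw⟩, fun h => ⟨fun y hy z hz => ?_, fun {y z w} hy hz hw => ?_⟩⟩
  · have hyγ := rank_lt_of_mem_Vt _ hy
    exact h.1 ⟨y, hyγ⟩ hy ⟨z, rank_lt_of_mem_Vt ⟨y, hyγ⟩ hz⟩ hz
  · have hwγ := rank_lt_of_mem_Vt _ hw
    have hzγ := rank_lt_of_mem_Vt ⟨w, hwγ⟩ hz
    exact h.2 ⟨w, hwγ⟩ hw ⟨z, hzγ⟩ hz ⟨y, rank_lt_of_mem_Vt ⟨z, hzγ⟩ hy⟩ hy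

theorem fInterp_eq_iff {γ : Ordinal} {f : Ordinal → Ordinal} {x y : Vt γ}
    (hf : f x.1.rank < γ) : fInterp γ f x = y ↔
      x.1.IsOrdinal ∧ y.1.IsOrdinal ∧ y.1.rank = f x.1.rank ∨ ¬ x.1.IsOrdinal ∧ x = y := by
  by_cases hx : x.1.IsOrdinal
  · have hex : x.1.IsOrdinal ∧ ∃ y : ZFSet, y.IsOrdinal ∧ y.rank = f x.1.rank ∧ y.rank < γ :=
      ⟨hx, (f x.1.rank).toZFSet, ZFSet.isOrdinal_toZFSet _, by simp, by simpa using hf⟩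
    obtain ⟨h1, h2, -⟩ := hex.2.choose_spec
    simp only [fInterp, dif_pos hex, hx, true_and, not_true_eq_false, false_and, or_false]
    constructor
    · rintro rfl
      exact ⟨h1, h2⟩
    · rintro ⟨h3, h4⟩
      exact Subtype.ext ((h1.rank_inj h3).1 (h2.trans h4.symm))
  · simp [fInterp, hx]

theorem UDefinable.fInterp_eq {α : Type} (x y : α) :
    UDefinable fun γ v => fInterp γ (localFailUplift γ) (v x) = v y := by
  have h : UDefinable fun γ v => (v x).1.IsOrdinal ∧ (v y).1.IsOrdinal ∧
      (v y).1.rank = localFailUplift γ (v x).1.rank ∨ ¬ (v x).1.IsOrdinal ∧ v x = v y :=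
    .or (.and (.isOrdinal _) (.and (.isOrdinal _) (.rank_eq_localFailUplift _ _)))
      (.and (.not (.isOrdinal _)) (.eq _ _))
  exact h.congr fun γ hγ v => fInterp_eq_iff (localFailUplift_lt hγ.pos _)

/-! ### Elementarity in the expanded language -/

theorem UDefinable.term_realize_eq {β : Type} (t : LF.Term β) :
    UDefinable fun γ (w : Option β → Vt γ) =>
      letI := LFStructure γ (localFailUplift γ)
      t.realize (fun b => w (some b)) = w none := by
  induction t with
  | var b => exact .eq (some b) none
  | func F ts ih =>
    obtain ⟨⟩ := F
    have h : UDefinable fun γ (w : Option β → Vt γ) => ∃ x : Vt γ,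
        (letI := LFStructure γ (localFailUplift γ); (ts 0).realize (fun b => w (some b)) = x) ∧
        fInterp γ (localFailUplift γ) x = w none :=
      .ex (.and ((ih 0).comap fun o => o.elim none fun b => some (some b)) (.fInterp_eq _ _))
    refine h.congr fun γ hγ w => ⟨fun h => ⟨_, rfl, h⟩, ?_⟩
    rintro ⟨x, rfl, h⟩
    exact h

theorem UDefinable.boundedFormula_realize {α : Type} {n : ℕ} (φ : LF.BoundedFormula α n) :
    UDefinable fun γ (w : α ⊕ Fin n → Vt γ) =>
      letI := LFStructure γ (localFailUplift γ)
      φ.Realize (fun a => w (.inl a)) (fun k => w (.inr k)) := by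
  have hw : ∀ {n : ℕ} {γ : Ordinal} (w : α ⊕ Fin n → Vt γ),
      Sum.elim (fun a => w (.inl a)) (fun k => w (.inr k)) = w := fun w => by
    funext x
    cases x <;> rfl
  induction φ with
  | falsum => exact ⟨⊥, fun γ hγ w => Iff.rfl⟩
  | @equal n t₁ t₂ =>
    have h : UDefinable fun γ (w : α ⊕ Fin n → Vt γ) => ∃ x : Vt γ,
        (letI := LFStructure γ (localFailUplift γ); t₁.realize w = x) ∧
        (letI := LFStructure γ (localFailUplift γ); t₂.realize w = x) :=
      .ex (.and (.term_realize_eq t₁) (.term_realize_eq t₂))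
    refine h.congr fun γ hγ w => ?_
    simp only [BoundedFormula.Realize, hw]
    exact ⟨fun h => ⟨_, h, rfl⟩, fun ⟨x, h1, h2⟩ => h1.trans h2.symm⟩
  | @rel n m R ts =>
    obtain ⟨⟩ := R
    have h : UDefinable fun γ (w : α ⊕ Fin n → Vt γ) => ∃ x y : Vt γ,
        (letI := LFStructure γ (localFailUplift γ); (ts 0).realize w = x) ∧
        (letI := LFStructure γ (localFailUplift γ); (ts 1).realize w = y) ∧ x.1 ∈ y.1 :=
      .ex (.ex (.and ((UDefinable.term_realize_eq (ts 0)).comap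
        fun o => o.elim (some none) fun b => some (some b))
        (.and ((UDefinable.term_realize_eq (ts 1)).comap
          fun o => o.elim none fun b => some (some b)) (.mem _ _))))
    refine h.congr fun γ hγ w => ?_
    simp only [BoundedFormula.Realize, hw]
    constructor
    · exact fun h => ⟨_, _, rfl, rfl, h⟩
    · rintro ⟨x, y, rfl, rfl, h⟩
      exact h
  | imp φ ψ ihφ ihψ => exact .imp ihφ ihψ
  | @all n φ ih =>
    have h : UDefinable fun γ (w : α ⊕ Fin n → Vt γ) => ∀ x : Vt γ,
        letI := LFStructure γ (localFailUplift γ)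
        φ.Realize (fun a => w (.inl a)) (Fin.snoc (fun k => w (.inr k)) x) := by
      refine .all ((ih.comap (Sum.elim (fun a => some (.inl a))
        (Fin.snoc (fun k => some (.inr k)) none))).congr fun γ hγ w => ?_)
      simp only [Sum.elim_inl, Sum.elim_inr]
      refine iff_of_eq (congrArg _ (funext fun k => ?_))
      refine Fin.lastCases ?_ (fun k => ?_) k <;> simp
    exact h

theorem VElem.fVElem {κ γ : Ordinal} (h : VElem κ γ) (hκ : IsInaccOrd κ) (hγ : IsInaccOrd γ)
    (hle : κ ≤ γ) {f : Ordinal → Ordinal} (hf : ∀ δ < κ, f δ = localFailUplift κ δ) :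
    FVElem κ γ f (localFailUplift γ) := by
  have hstr : LFStructure κ f = LFStructure κ (localFailUplift κ) := by
    have : fInterp κ f = fInterp κ (localFailUplift κ) := by
      funext x
      have hlt := localFailUplift_lt hκ.pos x.1.rank
      refine (fInterp_eq_iff (by rwa [hf _ x.2])).2 ?_
      rw [hf _ x.2]
      exact (fInterp_eq_iff hlt).1 rfl
    simp only [LFStructure, this]
  unfold FVElem
  rw [hstr]
  let := LFStructure κ (localFailUplift κ)
  let := LFStructure γ (localFailUplift γ)
  refine ⟨⟨fun x => ⟨x.1, x.2.trans_le hle⟩, fun n φ x => ?_⟩, fun x => rfl⟩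
  have := h.transfer hκ hγ hle (UDefinable.boundedFormula_realize φ) (Sum.elim x Fin.elim0)
  convert! this using 2
  exact iff_of_eq (congrArg (BoundedFormula.Realize φ _) (Subsingleton.elim _ _))

theorem failUplift_eq_localFailUplift {κ δ : Ordinal} (h : IsUplifting κ) (hδ : δ < κ) :
    failUplift δ = localFailUplift κ δ := by
  have hbounds : UDefinable fun γ (v : Bool → Vt γ) => ∀ m : Vt γ,
      IsInaccOrd m.1.rank ∧ VElem (v false).1.rank m.1.rank → m.1.rank ≤ (v true).1.rank :=
    .all (.imp (.velem (some false) none) (.rank_le _ _))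
  have hbdd : UDefinable fun γ (v : Unit → Vt γ) => ∃ b : Vt γ, ∀ m : Vt γ,
      IsInaccOrd m.1.rank ∧ VElem (v ()).1.rank m.1.rank → m.1.rank ≤ b.1.rank :=
    .ex (.all (.imp (.velem (some (some ())) none) (.rank_le _ _)))
  have hall : ∀ γ z : Ordinal, (∀ m : Vt γ, IsInaccOrd m.1.rank ∧ VElem δ m.1.rank →
      m.1.rank ≤ z) ↔ ∀ μ < γ, IsInaccOrd μ ∧ VElem δ μ → μ ≤ z := fun γ z =>
    forall_Vt_rank (P := fun μ => IsInaccOrd μ ∧ VElem δ μ → μ ≤ z)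
  by_cases hex : ∃ b < κ, ∀ μ < κ, IsInaccOrd μ ∧ VElem δ μ → μ ≤ b
  · obtain ⟨b, hb, hle⟩ := hex
    have hle' : ∀ μ, IsInaccOrd μ ∧ VElem δ μ → μ ≤ b := fun μ hμ => by
      obtain ⟨γ, hγ, hμγ, hκγ, hel⟩ := h.2 (Order.succ μ)
      have := (hel.transfer h.1 hγ hκγ.le hbounds fun i =>
        bif i then ⟨b.toZFSet, by simpa using hb⟩ else ⟨δ.toZFSet, by simpa using hδ⟩).2 (by
          simp only [cond_true, cond_false, Ordinal.rank_toZFSet, hall]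
          exact hle)
      simp only [cond_true, cond_false, Ordinal.rank_toZFSet, hall] at this
      exact this μ (Order.succ_le_iff.1 hμγ) hμ
    rw [localFailUplift, if_pos ⟨b, hb, hle⟩, failUplift]
    congr 1
    ext μ
    exact ⟨fun hμ => ⟨(hle' μ hμ).trans_lt hb, hμ⟩, And.right⟩
  · rw [localFailUplift, if_neg hex, failUplift]
    refine csSup_of_not_bddAbove ?_ |>.trans (by simp)
    rintro ⟨b, hb⟩
    obtain ⟨γ, hγ, hbγ, hκγ, hel⟩ := h.2 (Order.succ b)
    have := (hel.transfer h.1 hγ hκγ.le hbdd fun _ => ⟨δ.toZFSet, by simpa using hδ⟩).1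
      ⟨⟨b.toZFSet, by simpa using Order.succ_le_iff.1 hbγ⟩, fun m hm => by
        simpa using hb (by simpa using hm)⟩
    obtain ⟨c, hc⟩ := this
    simp only [Ordinal.rank_toZFSet, hall] at hc
    exact hex ⟨_, c.2, hc⟩

theorem IsUplifting.menasFor_failUplift {κ : Ordinal} (h : IsUplifting κ) :
    MenasFor failUplift κ := by
  refine ⟨fun δ hδ => ?_, fun θ => ?_⟩
  · rw [failUplift_eq_localFailUplift h hδ]
    exact localFailUplift_lt h.1.pos δ
  · obtain ⟨γ₀, hγ₀, hθ, hκ₀, hel₀⟩ := h.2 θ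
    have hne : {γ | γ₀ < γ ∧ IsInaccOrd γ ∧ VElem κ γ}.Nonempty := by
      obtain ⟨γ, hγ, hlt, -, hel⟩ := h.2 (Order.succ γ₀)
      exact ⟨γ, Order.succ_le_iff.1 hlt, hγ, hel⟩
    obtain ⟨hlt, hγ, hel⟩ := csInf_mem hne
    set γ := sInf {γ | γ₀ < γ ∧ IsInaccOrd γ ∧ VElem κ γ} with hγdef
    have hκγ := hκ₀.trans hlt
    refine ⟨γ, localFailUplift γ, hγ, hθ.trans hlt.le, hκγ, fun δ _ => localFailUplift_lt hγ.pos δ,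
      hel.fVElem h.1 hγ hκγ.le fun δ hδ => failUplift_eq_localFailUplift h hδ, hθ.trans ?_⟩
    have hle : ∀ μ < γ, IsInaccOrd μ ∧ VElem κ μ → μ ≤ γ₀ := fun μ hμ hw =>
      not_lt.1 fun h0 => hμ.not_ge (csInf_le' ⟨h0, hw⟩)
    exact (localFailUplift_le_iff hlt hle).1 le_rfl γ₀ hlt ⟨hγ₀, hel₀⟩

/-- Every uplifting cardinal has a function with the uplifting Menas property; indeed, the
failure-of-upliftingness function is such a function. -/
theorem uplifting_has_menas_function (κ : Ordinal) (h : IsUplifting κ) :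
    (∃ f : Ordinal → Ordinal, MenasFor f κ) ∧ MenasFor failUplift κ := by
  exact ⟨⟨failUplift, h.menasFor_failUplift⟩, h.menasFor_failUplift⟩

end Paper
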